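/- In the Migliore construction with α ≥ β + n − 2, if s ≤ β − 2, then A_n < β; that is, since d(Γ) = β, the lower bound A_n is not attained: d(Γ) > A_n. -/

import Mathlib

open MvPolynomial

noncomputable section

namespace PointsMinDist

variable {K : Type} [Field K]

/-- The (homogeneous) vanishing ideal of a set of points of projective space:
all polynomials vanishing at every representative vector of every point. -/
def vanishingIdeal {m : ℕ} (Γ : Set (Projectivization K (Fin m → K))) :
    Ideal (MvPolynomial (Fin m) K) where
  carrier := {f | ∀ P ∈ Γ, ∀ (v : Fin m → K) (hv : v ≠ 0),
      Projectivization.mk K v hv = P → MvPolynomial.eval v f = 0}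
  zero_mem' := by intro P hP v hv h; simp
  add_mem' := by
    intro f g hf hg P hP v hv h
    simp [hf P hP v hv h, hg P hP v hv h]
  smul_mem' := by
    intro c f hf P hP v hv h
    simp [smul_eq_mul, hf P hP v hv h]

/-- The degree-`d` graded component of a (homogeneous) ideal, as a `K`-subspace. -/
def degPart {m : ℕ} (I : Ideal (MvPolynomial (Fin m) K)) (d : ℕ) :
    Submodule K (MvPolynomial (Fin m) K) :=
  Submodule.restrictScalars K I ⊓ homogeneousSubmodule (Fin m) K d

/-- `K`-dimension of the degree-`d` component of an ideal. -/
def hdim {m : ℕ} (I : Ideal (MvPolynomial (Fin m) K)) (d : ℕ) : ℕ :=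
  Module.finrank K (degPart I d)

/-- Hilbert function of `R/I` in degree `d`. -/
def HF {m : ℕ} (I : Ideal (MvPolynomial (Fin m) K)) (d : ℕ) : ℕ :=
  Module.finrank K (homogeneousSubmodule (Fin m) K d) - hdim I d

open Classical in
/-- `hyp Γ`: the maximum number of points of `Γ` contained in a hyperplane. -/
def hyp {m : ℕ} (Γ : Finset (Projectivization K (Fin m → K))) : ℕ :=
  sSup {k | ∃ φ : Module.Dual K (Fin m → K), φ ≠ 0 ∧
    k = (Γ.filter fun P => φ P.rep = 0).card}

/-- the minimum distance `d(Γ) = |Γ| - hyp(Γ)`. -/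
def minDist {m : ℕ} (Γ : Finset (Projectivization K (Fin m → K))) : ℕ :=
  Γ.card - hyp Γ

/-- `Γ` is non-degenerate: it is not contained in any hyperplane. -/
def Nondeg {m : ℕ} (Γ : Finset (Projectivization K (Fin m → K))) : Prop :=
  ∀ φ : Module.Dual K (Fin m → K), (∀ P ∈ Γ, φ P.rep = 0) → φ = 0

/-- The higher minimum distance `d(Γ)ₐ = |Γ| - max{|Γ'| : Γ' ⊆ Γ, dim I(Γ')ₐ > dim I(Γ)ₐ}`. -/
def higherD {m : ℕ} (Γ : Finset (Projectivization K (Fin m → K))) (a : ℕ) : ℕ :=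
  Γ.card - sSup {k | ∃ Γ' ⊆ Γ,
    hdim (vanishingIdeal (Γ' : Set (Projectivization K (Fin m → K)))) a >
      hdim (vanishingIdeal (Γ : Set (Projectivization K (Fin m → K)))) a ∧ k = Γ'.card}

open Classical in
/-- The degree `δ(P)` of a point `P` in `Γ`: the least degree in which the ideal
of `Γ \ {P}` is strictly bigger than the ideal of `Γ`. -/
def pointDegree {m : ℕ} (Γ : Finset (Projectivization K (Fin m → K)))
    (P : Projectivization K (Fin m → K)) : ℕ :=
  sInf {d | hdim (vanishingIdeal ((Γ.erase P) : Set (Projectivization K (Fin m → K)))) d >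
    hdim (vanishingIdeal (Γ : Set (Projectivization K (Fin m → K)))) d}

/-- A graded minimal free resolution
`0 → F_len → ⋯ → F_1 → R → R/I → 0` of `R/I`, `R = K[x_0,…,x_{N-1}]`.
`F_j = ⊕_{i : Fin (rk j)} R(-(twist j i))` for `1 ≤ j ≤ len`.
The differential `F_1 → R` is given by `gen` (so that its image is `I`) and the
differential `F_{j+2} → F_{j+1}` is given (in matrix form, rows indexed by the
target) by `mat j`.  All entries are homogeneous of the appropriate degrees, and
minimality means all entries lie in the irrelevant maximal ideal
(zero constant coefficient). -/
structure MinFreeRes (N : ℕ) (K : Type) [Field K] (I : Ideal (MvPolynomial (Fin N) K)) where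
  len : ℕ
  rk : ℕ → ℕ
  twist : (j : ℕ) → Fin (rk j) → ℕ
  gen : Fin (rk 1) → MvPolynomial (Fin N) K
  mat : (j : ℕ) → Matrix (Fin (rk (j + 1))) (Fin (rk (j + 2))) (MvPolynomial (Fin N) K)
  rk_len_pos : 0 < rk len
  rk_eq_zero : ∀ j, len < j → rk j = 0
  gen_hom : ∀ i, (gen i).IsHomogeneous (twist 1 i)
  gen_min : ∀ i, constantCoeff (gen i) = 0
  gen_span : Ideal.span (Set.range gen) = I
  mat_hom : ∀ j i i', mat j i i' = 0 ∨
    ∃ d, (mat j i i').IsHomogeneous d ∧ d + twist (j + 1) i = twist (j + 2) i'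
  mat_min : ∀ j i i', constantCoeff (mat j i i') = 0
  exact_one : ∀ v : Fin (rk 1) → MvPolynomial (Fin N) K,
    (∑ i, v i * gen i = 0) ↔ v ∈ LinearMap.range (mat 0).mulVecLin
  exact_rest : ∀ j, LinearMap.ker (mat j).mulVecLin = LinearMap.range (mat (j + 1)).mulVecLin

/-- `a(Γ)`: the minimal twist `min_i {a_i}` occurring in the last module
`F_len = ⊕ R(-a_i)` of the minimal free resolution. -/
def MinFreeRes.aMin {N : ℕ} {K : Type} [Field K] {I : Ideal (MvPolynomial (Fin N) K)}
    (res : MinFreeRes N K I) : ℕ :=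
  Finset.univ.inf'
    (Finset.univ_nonempty_iff.mpr (Fin.pos_iff_nonempty.mp res.rk_len_pos))
    (fun i => res.twist res.len i)

/-- The minimum socle degree `A_n = min_i {a_i - n}` (here `n = len`, the length of
the resolution). -/
def MinFreeRes.A {N : ℕ} {K : Type} [Field K] {I : Ideal (MvPolynomial (Fin N) K)}
    (res : MinFreeRes N K I) : ℤ :=
  (res.aMin : ℤ) - res.len


/-- Embedding of points of `P^{m-1}` into the hyperplane `x_0 = 0` of `P^m`. -/
def embedPt {m : ℕ} (P : Projectivization K (Fin m → K)) :
    Projectivization K (Fin (m + 1) → K) :=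
  Projectivization.mk K (Fin.cons 0 P.rep) (by
    intro h
    apply P.rep_nonzero
    funext i
    simpa using congrFun h i.succ)

/-- The point `[1, c, 1, …, 1]` of `P^n` (a point on a line avoiding `x_0 = 0`). -/
def linePt (n : ℕ) (c : K) : Projectivization K (Fin (n + 1) → K) :=
  Projectivization.mk K (fun j => if (j : ℕ) = 1 then c else 1) (by
    intro h
    have h0 := congrFun h 0
    simp at h0)

open Classical in
/-- The set `Γ = Γ₁ ∪ Γ₂` of the Migliore construction: a set `Γ₀` of points of
`P^{n-1}` embedded into the hyperplane `x_0 = 0`, together with the points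
`[1, u_i, 1, …, 1]` on a line. -/
def MigGamma {n : ℕ} (Γ₀ : Finset (Projectivization K (Fin n → K)))
    {β : ℕ} (u : Fin β → K) : Finset (Projectivization K (Fin (n + 1) → K)) :=
  Γ₀.image embedPt ∪ Finset.univ.image (fun i => linePt n (u i))

/-- The ideal `I₁ = ⟨x_0, J⟩ ⊆ R = K[x_0, …, x_n]`, where
`J ⊆ S = K[x_1, …, x_n]` (vars of `S` indexed by `Fin n`, with `X i` of `S`
corresponding to `x_{i+1}` of `R`). -/
def I1 {n : ℕ} (J : Ideal (MvPolynomial (Fin n) K)) :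
    Ideal (MvPolynomial (Fin (n + 1)) K) :=
  Ideal.span {X 0} ⊔ Ideal.map (rename (Fin.succ : Fin n → Fin (n + 1))) J

/-- The polynomial `∏_{i=1}^β (u_i x_0 - x_1)`. -/
def prodPoly (n β : ℕ) (u : Fin β → K) : MvPolynomial (Fin (n + 1)) K :=
  ∏ i : Fin β, (C (u i) * X 0 - X 1)

/-- The ideal `I₂ = ⟨∏ (u_i x_0 - x_1), x_2 - x_0, …, x_n - x_0⟩` of the `β`
points `[1, u_i, 1, …, 1]` on a line. -/
def I2 (n β : ℕ) (u : Fin β → K) : Ideal (MvPolynomial (Fin (n + 1)) K) :=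
  Ideal.span ({prodPoly n β u} ∪
    {f | ∃ j : Fin (n + 1), 2 ≤ (j : ℕ) ∧ f = X j - X 0})

/-- The sequence `x_0, x_1^t, x_2, …, x_n`. -/
def ciList (K : Type) [Field K] (n t : ℕ) : List (MvPolynomial (Fin (n + 1)) K) :=
  X 0 :: X 1 ^ t :: ((List.finRange (n + 1)).drop 2).map X

/-- The complete intersection ideal `⟨x_0, x_1^t, x_2, …, x_n⟩`. -/
def CIdeal (K : Type) [Field K] (n t : ℕ) : Ideal (MvPolynomial (Fin (n + 1)) K) :=
  Ideal.span {f | f ∈ ciList K n t}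

/-- The set `𝒜 = {x_0(x_2 - x_0), …, x_0(x_n - x_0), x_0·∏(u_i x_0 - x_1)}`. -/
def calA (n β : ℕ) (u : Fin β → K) : Set (MvPolynomial (Fin (n + 1)) K) :=
  {f | ∃ j : Fin (n + 1), 2 ≤ (j : ℕ) ∧ f = X 0 * (X j - X 0)} ∪
    {X 0 * prodPoly n β u}


/-- Graded component in degree `e` of the summand `R(-t)`. -/
def gc {σ K : Type} [Field K] (t e : ℕ) : MvPolynomial σ K →ₗ[K] MvPolynomial σ K :=
  if t ≤ e then homogeneousComponent (e - t) else 0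

theorem hc_mul {σ K : Type} [Field K] {p : MvPolynomial σ K} {d : ℕ} (hp : p.IsHomogeneous d)
    (q : MvPolynomial σ K) (e : ℕ) :
    homogeneousComponent e (p * q) = if d ≤ e then p * homogeneousComponent (e - d) q else 0 := by
  classical
  have h1 : p * q = ∑ i ∈ Finset.range (q.totalDegree + 1), p * homogeneousComponent i q := by
    rw [← Finset.mul_sum, sum_homogeneousComponent]
  rw [h1, map_sum]
  have h2 : ∀ i, homogeneousComponent e (p * homogeneousComponent i q) =
      if d + i = e then p * homogeneousComponent i q else 0 := by
    intro i
    have : (p * homogeneousComponent i q) ∈ homogeneousSubmodule σ K (d + i) :=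
      hp.mul (homogeneousComponent_isHomogeneous i q)
    rw [homogeneousComponent_of_mem this]
    simp only [eq_comm]
  simp only [h2]
  split_ifs with hd
  · by_cases hq : e - d < q.totalDegree + 1
    · rw [Finset.sum_eq_single_of_mem (e - d) (Finset.mem_range.2 hq)]
      · rw [if_pos (by omega)]
      · intro b _ hb
        rw [if_neg (by omega)]
    · rw [homogeneousComponent_eq_zero _ _ (by omega), mul_zero]
      apply Finset.sum_eq_zero
      intro b hb
      rw [Finset.mem_range] at hb
      rw [if_neg (by omega)]
  · apply Finset.sum_eq_zero
    intro b hb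
    rw [if_neg (by omega)]

theorem gc_mul {σ K : Type} [Field K] {p : MvPolynomial σ K} {d : ℕ} (hp : p.IsHomogeneous d)
    (q : MvPolynomial σ K) (t e : ℕ) : gc t e (p * q) = p * gc (d + t) e q := by
  unfold gc
  split_ifs with h1 h2 h2
  · rw [hc_mul hp, if_pos (by omega)]; congr 3; omega
  · rw [hc_mul hp, if_neg (by omega)]; simp
  · omega
  · simp

theorem gc_idem {σ K : Type} [Field K] (t e : ℕ) (q : MvPolynomial σ K) :
    gc t e (gc t e q) = gc t e q := by
  unfold gc
  split_ifs with h
  · rw [homogeneousComponent_of_mem (homogeneousComponent_mem _ _), if_pos rfl]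
  · simp

theorem gc_succ {σ K : Type} [Field K] (t e : ℕ) :
    (gc (1 + t) (e + 1) : MvPolynomial σ K →ₗ[K] _) = gc t e := by
  unfold gc
  have : (e + 1 - (1 + t)) = e - t := by omega
  rw [this]
  congr 1
  simp; omega

/-- Ideals generated by the first `k` elements. -/
def idl {R : Type} [CommRing R] (y : ℕ → R) : ℕ → Ideal R
  | 0 => ⊥
  | k + 1 => idl y k ⊔ Ideal.span {y k}

theorem mem_idl_succ {R : Type} [CommRing R] (y : ℕ → R) (k : ℕ) (x : R) :
    x ∈ idl y (k + 1) ↔ ∃ a, ∃ b ∈ idl y k, x = y k * a + b := by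
  rw [idl, Submodule.mem_sup]
  constructor
  · rintro ⟨b, hb, c, hc, rfl⟩
    obtain ⟨a, rfl⟩ := Ideal.mem_span_singleton'.1 hc
    exact ⟨a, b, hb, by ring⟩
  · rintro ⟨a, b, hb, rfl⟩
    exact ⟨b, hb, y k * a, Ideal.mul_mem_right _ _ (Ideal.mem_span_singleton_self _), by ring⟩

theorem gc_idl {σ K : Type} [Field K] (y : ℕ → MvPolynomial σ K)
    (k : ℕ) (hy : ∀ i < k, (y i).IsHomogeneous 1) (t e : ℕ) (q : MvPolynomial σ K)
    (hq : q ∈ idl y k) : gc t e q ∈ idl y k := by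
  induction k generalizing t e q with
  | zero => 
    have : q = 0 := hq
    simp [this]
  | succ k ih =>
    rw [mem_idl_succ] at hq ⊢
    obtain ⟨a, b, hb, rfl⟩ := hq
    exact ⟨gc (1 + t) e a, gc t e b, ih (fun i hi => hy i (by omega)) _ _ _ hb, by
      rw [map_add, gc_mul (hy k (by omega))]⟩

/-- vectors with all entries in an ideal -/
def vecI {R : Type} [CommRing R] (J : Ideal R) (r : ℕ) : Submodule R (Fin r → R) where
  carrier := {w | ∀ i, w i ∈ J}
  zero_mem' := by intro i; simp
  add_mem' := by intro a b ha hb i; exact J.add_mem (ha i) (hb i)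
  smul_mem' := by intro c a ha i; exact J.mul_mem_left _ (ha i)

theorem mem_vecI_succ {R : Type} [CommRing R] (y : ℕ → R) (k r : ℕ) (x : Fin r → R) :
    x ∈ vecI (idl y (k + 1)) r ↔ ∃ a, ∃ b ∈ vecI (idl y k) r, x = y k • a + b := by
  constructor
  · intro h
    have h' : ∀ i, ∃ a, ∃ b ∈ idl y k, x i = y k * a + b := fun i => (mem_idl_succ _ _ _).1 (h i)
    choose a b hb hab using h'
    exact ⟨a, b, hb, funext hab⟩
  · rintro ⟨a, b, hb, rfl⟩ i
    exact (mem_idl_succ _ _ _).2 ⟨a i, b i, hb i, rfl⟩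

theorem map_vecI {R : Type} [CommRing R] (J : Ideal R) {r r' : ℕ} (D : Matrix (Fin r) (Fin r') R)
    {w : Fin r' → R} (hw : w ∈ vecI J r') : D.mulVecLin w ∈ vecI J r := by
  intro i
  simp only [Matrix.mulVecLin_apply, Matrix.mulVec, dotProduct]
  exact J.sum_mem fun j _ => J.mul_mem_left _ (hw j)

theorem vec_reg {R : Type} [CommRing R] (y : ℕ → R) (k r : ℕ)
    (hreg : ∀ a, y k * a ∈ idl y k → a ∈ idl y k) (w : Fin r → R)
    (hw : y k • w ∈ vecI (idl y k) r) : w ∈ vecI (idl y k) r := fun i => hreg _ (hw i)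

theorem torVanish {R : Type} [CommRing R] (y : ℕ → R) (n : ℕ)
    (hreg : ∀ k < n, ∀ a, y k * a ∈ idl y k → a ∈ idl y k)
    (r : ℕ → ℕ) (D : ∀ j, Matrix (Fin (r j)) (Fin (r (j + 1))) R)
    (hex : ∀ j, LinearMap.ker (D j).mulVecLin = LinearMap.range (D (j + 1)).mulVecLin)
    (k : ℕ) : ∀ (j : ℕ), k ≤ n → k ≤ j → ∀ x ∈ LinearMap.range (D j).mulVecLin,
      x ∈ vecI (idl y k) (r j) → ∃ b ∈ vecI (idl y k) (r (j + 1)), (D j).mulVecLin b = x := by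
  induction k with
  | zero =>
    intro j _ _ x _ hx
    refine ⟨0, Submodule.zero_mem _, ?_⟩
    rw [map_zero]
    funext i
    exact (hx i : x i = 0).symm
  | succ k ih =>
    intro j hkn hkj x hxr hx
    obtain ⟨j, rfl⟩ : ∃ j', j = j' + 1 := ⟨j - 1, by omega⟩
    obtain ⟨w, b, hb, rfl⟩ := (mem_vecI_succ _ _ _ _).1 hx
    rw [← hex, LinearMap.mem_ker, map_add, map_smul] at hxr
    have h1 : (D j).mulVecLin w ∈ vecI (idl y k) (r j) := by
      apply vec_reg y k _ (hreg k (by omega))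
      rw [eq_neg_of_add_eq_zero_left hxr]
      exact Submodule.neg_mem _ (map_vecI _ _ hb)
    obtain ⟨c, hc, hcw⟩ := ih j (by omega) (by omega) _ ⟨w, rfl⟩ h1
    have hz : w - c ∈ LinearMap.range (D (j + 1)).mulVecLin := by
      rw [← hex, LinearMap.mem_ker, map_sub, hcw, sub_self]
    obtain ⟨z, hz⟩ := hz
    have h2 : y k • c + b ∈ LinearMap.range (D (j + 1)).mulVecLin := by
      rw [← hex, LinearMap.mem_ker, map_add, map_smul, hcw, hxr]
    obtain ⟨q, hq, hq'⟩ := ih (j + 1) (by omega) (by omega) _ h2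
      (Submodule.add_mem _ (Submodule.smul_mem _ _ hc) hb)
    refine ⟨y k • z + q, (mem_vecI_succ _ _ _ _).2 ⟨z, q, hq, rfl⟩, ?_⟩
    rw [map_add, map_smul, hz, hq', smul_sub]
    abel

/-- graded component of a vector -/
def comp {σ K : Type} [Field K] {r : ℕ} (tw : Fin r → ℕ) (e : ℕ) (w : Fin r → MvPolynomial σ K) :
    Fin r → MvPolynomial σ K := fun i => gc (tw i) e (w i)

theorem comp_map {σ K : Type} [Field K] {r r' : ℕ} (tw : Fin r → ℕ) (tw' : Fin r' → ℕ)
    (D : Matrix (Fin r) (Fin r') (MvPolynomial σ K))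
    (hD : ∀ i i', D i i' = 0 ∨ ∃ d, (D i i').IsHomogeneous d ∧ d + tw i = tw' i') (e : ℕ)
    (w : Fin r' → MvPolynomial σ K) :
    comp tw e (D.mulVecLin w) = D.mulVecLin (comp tw' e w) := by
  funext i
  simp only [comp, Matrix.mulVecLin_apply, Matrix.mulVec, dotProduct, map_sum]
  refine Finset.sum_congr rfl fun i' _ => ?_
  rcases hD i i' with h | ⟨d, h, hd⟩
  · simp [h]
  · rw [gc_mul h, hd]

theorem comp_smul {σ K : Type} [Field K] {r : ℕ} (tw : Fin r → ℕ) (e : ℕ)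
    {y : MvPolynomial σ K} (hy : y.IsHomogeneous 1) (w : Fin r → MvPolynomial σ K) :
    comp tw (e + 1) (y • w) = y • comp tw e w := by
  funext i
  simp only [comp, Pi.smul_apply, smul_eq_mul]
  rw [gc_mul hy, gc_succ]

theorem comp_add {σ K : Type} [Field K] {r : ℕ} (tw : Fin r → ℕ) (e : ℕ)
    (w w' : Fin r → MvPolynomial σ K) :
    comp tw e (w + w') = comp tw e w + comp tw e w' := by
  funext i
  simp [comp]

theorem koszulStep {σ K : Type} [Field K] (y : ℕ → MvPolynomial σ K) (n d : ℕ)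
    (hy : ∀ i < n, (y i).IsHomogeneous 1)
    (hreg : ∀ k < n, ∀ a, y k * a ∈ idl y k → a ∈ idl y k)
    (r : ℕ → ℕ) (tw : ∀ j, Fin (r j) → ℕ)
    (D : ∀ j, Matrix (Fin (r j)) (Fin (r (j + 1))) (MvPolynomial σ K))
    (hD : ∀ j i i', D j i i' = 0 ∨ ∃ d, (D j i i').IsHomogeneous d ∧ d + tw j i = tw (j + 1) i')
    (hex : ∀ j, LinearMap.ker (D j).mulVecLin = LinearMap.range (D (j + 1)).mulVecLin)
    (f : Fin (r 0) → MvPolynomial σ K) (hf : comp (tw 0) d f = f)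
    (hfI : f ∉ LinearMap.range (D 0).mulVecLin)
    (hyf : ∀ i < n, y i • f ∈ LinearMap.range (D 0).mulVecLin) (k : ℕ) (hk : k ≤ n) :
    ∃ w : Fin (r k) → MvPolynomial σ K, comp (tw k) (d + k) w = w ∧
      w ∉ vecI (idl y k) (r k) ⊔ LinearMap.range (D k).mulVecLin ∧
      ∀ i < n, y i • w ∈ vecI (idl y k) (r k) ⊔ LinearMap.range (D k).mulVecLin := by
  induction k with
  | zero =>
    have h0 : vecI (idl y 0) (r 0) = ⊥ := by
      rw [eq_bot_iff]
      intro x hx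
      exact funext fun i => hx i
    exact ⟨f, hf, by rwa [h0, bot_sup_eq], by rwa [h0, bot_sup_eq]⟩
  | succ k ih =>
    obtain ⟨w, hw, hwn, hyw⟩ := ih (by omega)
    obtain ⟨m₀, hm₀, _, ⟨w₀, rfl⟩, h₀⟩ := Submodule.mem_sup.1 (hyw k (by omega))
    set m := comp (tw k) (d + k + 1) m₀ with hmdef
    set w' := comp (tw (k + 1)) (d + k + 1) w₀ with hwdef
    have hm : m ∈ vecI (idl y k) (r k) := fun i =>
      gc_idl y k (fun i hi => hy i (by omega)) _ _ _ (hm₀ i)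
    have hmw : m + (D k).mulVecLin w' = y k • w := by
      rw [hmdef, hwdef, ← comp_map _ _ _ (hD k), ← comp_add, h₀, comp_smul _ _ (hy k (by omega)),
        hw]
    refine ⟨w', ?_, ?_, ?_⟩
    · funext i
      exact gc_idem _ _ _
    · intro hcon
      obtain ⟨p, hp, q, hq, hpq⟩ := Submodule.mem_sup.1 hcon
      obtain ⟨a, b, hb, rfl⟩ := (mem_vecI_succ _ _ _ _).1 hp
      rw [← hex, LinearMap.mem_ker] at hq
      apply hwn
      have h1 : y k • (w - (D k).mulVecLin a) ∈ vecI (idl y k) (r k) := by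
        have : y k • (w - (D k).mulVecLin a) = m + (D k).mulVecLin b := by
          rw [smul_sub, ← hmw, ← hpq, map_add, map_add, hq, map_smul]
          abel
        rw [this]
        exact Submodule.add_mem _ hm (map_vecI _ _ hb)
      have h2 := vec_reg y k _ (hreg k (by omega)) _ h1
      exact Submodule.mem_sup.2 ⟨_, h2, _, ⟨a, rfl⟩, by abel⟩
    · intro j hj
      obtain ⟨mj, hmj, _, ⟨wj, rfl⟩, hj'⟩ := Submodule.mem_sup.1 (hyw j hj)
      have h1 : (D k).mulVecLin (y j • w' - y k • wj) = y k • mj - y j • m := by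
        rw [map_sub, map_smul, map_smul, eq_sub_of_add_eq' hmw, eq_sub_of_add_eq' hj',
          smul_sub, smul_sub, smul_comm (y j) (y k) w]
        abel
      obtain ⟨b, hb, hb'⟩ := torVanish y n hreg r D hex k k (by omega) le_rfl _ ⟨_, h1⟩
        (Submodule.sub_mem _ (Submodule.smul_mem _ _ hmj) (Submodule.smul_mem _ _ hm))
      have h2 : y j • w' - y k • wj - b ∈ LinearMap.range (D (k + 1)).mulVecLin := by
        rw [← hex, LinearMap.mem_ker, map_sub, h1, hb', sub_self]
      exact Submodule.mem_sup.2 ⟨y k • wj + b, (mem_vecI_succ _ _ _ _).2 ⟨wj, b, hb, rfl⟩, _, h2,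
        by abel⟩

/-- The substitution killing the first `k` forms. -/
def psi {N : ℕ} {K : Type} [Field K] (τ : ℕ → Fin N) (κ : Fin N) (v : Fin N → K) (k : ℕ) :
    MvPolynomial (Fin N) K →ₐ[K] MvPolynomial (Fin N) K :=
  open Classical in aeval fun i => if ∃ l < k, τ l = i then C (v i) * X κ else X i

theorem linForms_reg {N n : ℕ} {K : Type} [Field K] (τ : ℕ → Fin N) (κ : Fin N) (v : Fin N → K)
    (hτ : ∀ i < n, ∀ j < n, τ i = τ j → i = j) (hκ : ∀ i < n, τ i ≠ κ) :
    ∀ k < n, ∀ a, (X (τ k) - C (v (τ k)) * X κ) * a ∈ idl (fun i => X (τ i) - C (v (τ i)) * X κ) k →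
      a ∈ idl (fun i => (X (τ i) - C (v (τ i)) * X κ : MvPolynomial (Fin N) K)) k := by
  classical
  intro k hk a
  set y : ℕ → MvPolynomial (Fin N) K := fun i => (X (τ i) - C (v (τ i)) * X κ) with hy
  have hyk : ∀ l, l ≤ k → ∀ m < l, y m ∈ idl y l := by
    intro l hl m hm
    induction l with
    | zero => omega
    | succ l ih =>
      rcases Nat.lt_succ_iff_lt_or_eq.1 hm with h | rfl
      · exact Ideal.mem_sup_left (ih (by omega) h)
      · exact Ideal.mem_sup_right (Ideal.mem_span_singleton_self _)
  have hκ' : ¬ ∃ l < k, τ l = κ := by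
    rintro ⟨l, hl, h⟩
    exact hκ l (by omega) h
  have h1 : ∀ l ≤ k, ∀ b ∈ idl y l, psi τ κ v k b = 0 := by
    intro l hl
    induction l with
    | zero => intro b hb; rw [show b = 0 from hb, map_zero]
    | succ l ih =>
      intro b hb
      obtain ⟨p, q, hq, rfl⟩ := (mem_idl_succ _ _ _).1 hb
      have : psi τ κ v k (y l) = 0 := by
        simp only [psi, hy, map_sub, map_mul, aeval_X, aeval_C]
        rw [if_pos ⟨l, by omega, rfl⟩, if_neg hκ']
        simp [algebraMap_eq]
      rw [map_add, map_mul, this, zero_mul, zero_add, ih (by omega) q hq]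
  have h2 : ∀ b, psi τ κ v k b = 0 → b ∈ idl y k := by
    have : ((Ideal.Quotient.mkₐ K (idl y k)).comp (psi τ κ v k)) = Ideal.Quotient.mkₐ K (idl y k) := by
      apply MvPolynomial.algHom_ext
      intro i
      simp only [AlgHom.comp_apply, psi, aeval_X, Ideal.Quotient.mkₐ_eq_mk]
      split_ifs with h
      · obtain ⟨l, hl, rfl⟩ := h
        rw [eq_comm, Ideal.Quotient.eq]
        exact hyk k le_rfl l hl
      · rfl
    intro b hb
    have h3 := DFunLike.congr_fun this b
    rw [AlgHom.comp_apply, hb, map_zero] at h3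
    exact Ideal.Quotient.eq_zero_iff_mem.1 h3.symm
  have h3 : psi τ κ v k (X (τ k) - C (v (τ k)) * X κ) ≠ 0 := by
    simp only [psi, map_sub, map_mul, aeval_X, aeval_C]
    rw [if_neg hκ', if_neg]
    · intro h
      have := congrArg (coeff (Finsupp.single (τ k) 1)) h
      simp [algebraMap_eq, coeff_C_mul, coeff_X, Finsupp.single_left_inj, (hκ k hk).symm] at this
    · rintro ⟨l, hl, h⟩
      have := hτ l (by omega) k hk h
      omega
  intro ha
  apply h2
  have := h1 k le_rfl _ ha
  rw [map_mul] at this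
  exact (mul_eq_zero.1 this).resolve_left h3

section ResolutionExtended

variable {N : ℕ} {F : Type} [Field F] {J : Ideal (MvPolynomial (Fin N) F)}

/-- ranks including `F_0 = R` -/
def xrk (res : MinFreeRes N F J) : ℕ → ℕ
  | 0 => 1
  | j + 1 => res.rk (j + 1)

/-- twists including `F_0 = R` -/
def xtw (res : MinFreeRes N F J) : (j : ℕ) → Fin (xrk res j) → ℕ
  | 0 => fun _ => 0
  | j + 1 => res.twist (j + 1)

/-- differentials including `F_1 → R` -/
def xD (res : MinFreeRes N F J) :
    (j : ℕ) → Matrix (Fin (xrk res j)) (Fin (xrk res (j + 1))) (MvPolynomial (Fin N) F)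
  | 0 => fun _ i => res.gen i
  | j + 1 => res.mat j

theorem xD_hom (res : MinFreeRes N F J) : ∀ j i i', xD res j i i' = 0 ∨
    ∃ d, (xD res j i i').IsHomogeneous d ∧ d + xtw res j i = xtw res (j + 1) i'
  | 0 => fun _ i' => Or.inr ⟨_, res.gen_hom i', rfl⟩
  | j + 1 => res.mat_hom j

theorem xD_zero_apply (res : MinFreeRes N F J) (v : Fin (res.rk 1) → MvPolynomial (Fin N) F)
    (i : Fin 1) : (xD res 0).mulVecLin v i = ∑ k, v k * res.gen k := by
  change ∑ k, res.gen k * v k = _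
  exact Finset.sum_congr rfl fun k _ => mul_comm _ _

theorem xD_exact (res : MinFreeRes N F J) : ∀ j, LinearMap.ker (xD res j).mulVecLin =
    LinearMap.range (xD res (j + 1)).mulVecLin
  | 0 => by
    ext v
    refine Iff.trans ?_ (res.exact_one v)
    rw [LinearMap.mem_ker]
    constructor
    · intro h
      rw [← xD_zero_apply res v 0, h]; rfl
    · intro h
      funext i
      rw [xD_zero_apply res v i, h]; rfl
  | j + 1 => res.exact_rest j

theorem xD_range (res : MinFreeRes N F J) (f : MvPolynomial (Fin N) F) :
    (fun _ => f : Fin 1 → MvPolynomial (Fin N) F) ∈ LinearMap.range (xD res 0).mulVecLin ↔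
      f ∈ J := by
  conv_rhs => rw [← res.gen_span, Ideal.mem_span_range_iff_exists_fun]
  constructor
  · rintro ⟨c, hc⟩
    refine ⟨c, ?_⟩
    rw [← xD_zero_apply res c 0, hc]
  · rintro ⟨c, hc⟩
    refine ⟨c, funext fun i => ?_⟩
    rw [xD_zero_apply res c i, hc]

end ResolutionExtended

theorem A_le_of_twist {N : ℕ} {F : Type} [Field F] {J : Ideal (MvPolynomial (Fin N) F)}
    (res : MinFreeRes N F J) (k d : ℕ) (hk : res.len = k)
    (h : ∃ i : Fin (res.rk k), res.twist k i ≤ d + k) : res.A ≤ d := by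
  subst hk
  obtain ⟨i, hi⟩ := h
  have : res.aMin ≤ res.twist res.len i := Finset.inf'_le _ (Finset.mem_univ i)
  unfold MinFreeRes.A
  omega

theorem A_le_of_sep {n : ℕ} {F : Type} [Field F] {J : Ideal (MvPolynomial (Fin (n + 1)) F)}
    (res : MinFreeRes (n + 1) F J) (hn : 0 < n) (hlen : res.len = n) (d : ℕ)
    (f : MvPolynomial (Fin (n + 1)) F) (hf : f.IsHomogeneous d) (hfJ : f ∉ J)
    (κ : Fin (n + 1)) (v : Fin (n + 1) → F)
    (hy : ∀ i, (X i - C (v i) * X κ) * f ∈ J) : res.A ≤ d := by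
  apply A_le_of_twist res n d hlen
  let τ : ℕ → Fin (n + 1) := fun i => if h : i < n then κ.succAbove ⟨i, h⟩ else κ
  have hτ : ∀ i < n, ∀ j < n, τ i = τ j → i = j := by
    intro i hi j hj h
    simp only [τ, dif_pos hi, dif_pos hj] at h
    simpa using Fin.succAbove_right_injective h
  have hκ : ∀ i < n, τ i ≠ κ := by
    intro i hi
    simp only [τ, dif_pos hi]
    exact Fin.succAbove_ne _ _
  obtain ⟨w, hw, hwn, -⟩ := koszulStep (fun i => X (τ i) - C (v (τ i)) * X κ) n d
    (fun i _ => by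
      apply IsHomogeneous.sub (isHomogeneous_X _ _)
      simpa using (isHomogeneous_C (Fin (n + 1)) (v (τ i))).mul (isHomogeneous_X F κ))
    (linForms_reg τ κ v hτ hκ) (xrk res) (xtw res) (xD res) (xD_hom res) (xD_exact res)
    (fun _ => f) (by
      funext i
      have : xtw res 0 i = 0 := rfl
      simp only [comp, this, gc]
      simp [homogeneousComponent_of_mem (show f ∈ homogeneousSubmodule _ _ d from hf)])
    (fun h => hfJ ((xD_range res f).1 h))
    (fun i _ => (xD_range res _).2 (hy (τ i))) n le_rfl
  obtain ⟨n, rfl⟩ : ∃ m, n = m + 1 := ⟨n - 1, by omega⟩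
  by_contra hcon
  push Not at hcon
  apply hwn
  have : w = 0 := by
    rw [← hw]
    funext i
    have h : ¬ xtw res (n + 1) i ≤ d + (n + 1) := not_le.2 (hcon i)
    simp [comp, gc, h]
  rw [this]
  exact Submodule.zero_mem _

theorem eval_smul_hom {σ F : Type} [Field F] {f : MvPolynomial σ F} {d : ℕ}
    (hf : f.IsHomogeneous d) (c : F) (w : σ → F) : eval (c • w) f = c ^ d * eval w f := by
  rw [eval_eq, eval_eq, Finset.mul_sum]
  refine Finset.sum_congr rfl fun m hm => ?_
  have hd : ∑ i ∈ m.support, m i = d := by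
    have := hf (mem_support_iff.1 hm)
    rwa [Finsupp.weight_apply, Finsupp.sum, Finset.sum_congr rfl
      (fun i _ => show m i • (1 : σ → ℕ) i = m i by simp)] at this
  simp only [Pi.smul_apply, smul_eq_mul, mul_pow, Finset.prod_mul_distrib]
  rw [Finset.prod_pow_eq_pow_sum, hd]
  ring

theorem exists_sep {m : ℕ} {F : Type} [Field F]
    (G : Finset (Projectivization F (Fin m → F))) (s : ℕ)
    (hG : 0 < G.card)
    (h : HF (vanishingIdeal (G : Set (Projectivization F (Fin m → F)))) s = G.card)
    (Q : Projectivization F (Fin m → F)) (hQ : Q ∈ G) :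
    ∃ f : MvPolynomial (Fin m) F, f.IsHomogeneous s ∧ eval Q.rep f ≠ 0 ∧
      ∀ P ∈ G, P ≠ Q → eval P.rep f = 0 := by
  classical
  let ev : homogeneousSubmodule (Fin m) F s →ₗ[F] (G → F) :=
    LinearMap.pi fun P => ((aeval P.1.rep : MvPolynomial (Fin m) F →ₐ[F] F).toLinearMap).comp
      (Submodule.subtype _)
  have hev : ∀ f P, ev f P = eval P.1.rep f.1 := by
    intro f P
    simp [ev, aeval_eq_eval]
  have hfin : 0 < Module.finrank F (homogeneousSubmodule (Fin m) F s) := by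
    unfold HF at h; omega
  have : FiniteDimensional F (homogeneousSubmodule (Fin m) F s) :=
    Module.finite_of_finrank_pos hfin
  have hker : Module.finrank F (LinearMap.ker ev) =
      hdim (vanishingIdeal (G : Set (Projectivization F (Fin m → F)))) s := by
    have : (LinearMap.ker ev).map (Submodule.subtype _) =
        degPart (vanishingIdeal (G : Set (Projectivization F (Fin m → F)))) s := by
      ext f
      constructor
      · rintro ⟨f, hf, rfl⟩
        refine ⟨?_, f.2⟩
        intro P hP v hv hvP
        subst hvP
        obtain ⟨a, ha⟩ := Projectivization.exists_smul_eq_mk_rep F v hv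
        have h1 := congrFun (LinearMap.mem_ker.1 hf) ⟨_, hP⟩
        rw [hev] at h1
        simp only [← ha, Units.smul_def] at h1
        rw [eval_smul_hom f.2] at h1
        exact (mul_eq_zero.1 h1).resolve_left (pow_ne_zero _ a.ne_zero)
      · rintro ⟨hf1, hf2⟩
        refine ⟨⟨f, hf2⟩, ?_, rfl⟩
        rw [SetLike.mem_coe, LinearMap.mem_ker]
        funext P
        rw [hev]
        exact hf1 P.1 P.2 _ P.1.rep_nonzero P.1.mk_rep
    rw [hdim, ← this]
    exact (Submodule.finrank_map_subtype_eq _ _).symm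
  have hrn := LinearMap.finrank_range_add_finrank_ker ev
  have hsurj : LinearMap.range ev = ⊤ := by
    apply Submodule.eq_top_of_finrank_eq
    rw [Module.finrank_fintype_fun_eq_card, Fintype.card_coe]
    unfold HF at h
    omega
  obtain ⟨f, hf⟩ := LinearMap.range_eq_top.1 hsurj (Pi.single ⟨Q, hQ⟩ 1)
  refine ⟨f.1, f.2, ?_, ?_⟩
  · rw [← hev f ⟨Q, hQ⟩, hf]; simp
  · intro P hP hPQ
    rw [← hev f ⟨P, hP⟩, hf, Pi.single_eq_of_ne]
    intro h'
    exact hPQ (congrArg Subtype.val h')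

theorem embedPt_inj {m : ℕ} {F : Type} [Field F] :
    Function.Injective (embedPt : Projectivization F (Fin m → F) → _) := by
  intro P Q h
  unfold embedPt at h
  rw [Projectivization.mk_eq_mk_iff'] at h
  obtain ⟨a, ha⟩ := h
  rw [← P.mk_rep, ← Q.mk_rep, Projectivization.mk_eq_mk_iff']
  refine ⟨a, funext fun i => ?_⟩
  simpa using congrFun ha i.succ

theorem linePt_inj {n : ℕ} (hn : 2 ≤ n) {F : Type} [Field F] :
    Function.Injective (linePt n : F → _) := by
  intro c c' h
  unfold linePt at h
  rw [Projectivization.mk_eq_mk_iff'] at h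
  obtain ⟨a, ha⟩ := h
  have h0 := congrFun ha 0
  have h1 := congrFun ha ⟨1, by omega⟩
  simp at h0 h1
  rw [h0] at h1
  simpa using h1.symm

theorem embed_ne_line {n : ℕ} {F : Type} [Field F] (P : Projectivization F (Fin n → F)) (c : F) :
    embedPt P ≠ linePt n c := by
  intro h
  unfold linePt embedPt at h
  rw [Projectivization.mk_eq_mk_iff'] at h
  obtain ⟨a, ha⟩ := h
  have h0 := congrFun ha 0
  have h1 : ∀ i, (Fin.cons 0 P.rep : Fin (n + 1) → F) i = 0 := by
    intro i
    rw [← ha]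
    simp at h0
    simp [h0]
  exact P.rep_nonzero (funext fun i => by simpa using h1 i.succ)

theorem card_mig {n β : ℕ} (hn : 2 ≤ n) {F : Type} [Field F]
    (G : Finset (Projectivization F (Fin n → F))) (u : Fin β → F) (hu : Function.Injective u) :
    (MigGamma G u).card = G.card + β := by
  classical
  unfold MigGamma
  rw [Finset.card_union_of_disjoint, Finset.card_image_of_injective _ embedPt_inj,
    Finset.card_image_of_injective (f := fun i => linePt n (u i)) _ ((linePt_inj hn).comp hu), Finset.card_univ, Fintype.card_fin]
  rw [Finset.disjoint_left]
  intro x hx hx'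
  obtain ⟨P, -, rfl⟩ := Finset.mem_image.1 hx
  obtain ⟨i, -, h⟩ := Finset.mem_image.1 hx'
  exact embed_ne_line _ _ h.symm

theorem mig_sep {n β : ℕ} {F : Type} [Field F]
    (G : Finset (Projectivization F (Fin n → F))) (u : Fin β → F) (s : ℕ)
    (Q : Projectivization F (Fin n → F)) (hQ : Q ∈ G) (j : Fin n) (hj : 1 ≤ (j : ℕ))
    (hQj : Q.rep j ≠ 0) (f : MvPolynomial (Fin n) F) (hf : f.IsHomogeneous s)
    (hfQ : eval Q.rep f ≠ 0) (hfP : ∀ P ∈ G, P ≠ Q → eval P.rep f = 0) :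
    ∃ (g : MvPolynomial (Fin (n + 1)) F) (κ : Fin (n + 1)) (v : Fin (n + 1) → F),
      g.IsHomogeneous (s + 1) ∧
      g ∉ vanishingIdeal (MigGamma G u : Set (Projectivization F (Fin (n + 1) → F))) ∧
      ∀ i, (X i - C (v i) * X κ) * g ∈
        vanishingIdeal (MigGamma G u : Set (Projectivization F (Fin (n + 1) → F))) := by
  classical
  refine ⟨rename Fin.succ f * (X j.succ - X 0), j.succ,
    fun i => (Fin.cons 0 Q.rep : Fin (n + 1) → F) i / Q.rep j, ?_, ?_, ?_⟩
  · exact (hf.rename_isHomogeneous).mul ((isHomogeneous_X _ _).sub (isHomogeneous_X _ _))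
  · intro h
    have hmem : embedPt Q ∈ (MigGamma G u : Set (Projectivization F (Fin (n + 1) → F))) := by
      simp only [MigGamma, Finset.coe_union, Finset.coe_image]
      exact Or.inl ⟨Q, hQ, rfl⟩
    have := h _ hmem _ _ rfl
    rw [map_mul, eval_rename] at this
    simp only [map_sub, eval_X, Fin.cons_succ, Fin.cons_zero, sub_zero, mul_eq_zero, hQj,
      or_false] at this
    exact hfQ this
  · intro i P hP w hw hwP
    simp only [MigGamma, Finset.coe_union, Finset.coe_image] at hP
    rcases hP with ⟨P, hP, rfl⟩ | ⟨l, -, rfl⟩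
    · unfold embedPt at hwP
      rw [Projectivization.mk_eq_mk_iff'] at hwP
      obtain ⟨a, rfl⟩ := hwP
      by_cases hPQ : P = Q
      · subst hPQ
        rw [map_mul]
        have : eval (a • (Fin.cons 0 P.rep : Fin (n + 1) → F))
            (X i - C ((Fin.cons 0 P.rep : Fin (n + 1) → F) i / P.rep j) * X j.succ) = 0 := by
          simp only [map_sub, map_mul, eval_X, eval_C, Pi.smul_apply, Fin.cons_succ, smul_eq_mul]
          field_simp
          ring
        rw [this, zero_mul]
      · rw [map_mul, map_mul, eval_rename]
        have : ((a • (Fin.cons 0 P.rep : Fin (n + 1) → F)) ∘ Fin.succ) = a • P.rep := by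
          funext i; simp
        rw [this, eval_smul_hom hf, hfP P hP hPQ]
        simp
    · simp only [linePt] at hwP
      rw [Projectivization.mk_eq_mk_iff'] at hwP
      obtain ⟨a, rfl⟩ := hwP
      have hj' : (j : ℕ) ≠ 0 := by omega
      simp [hj']

/-- In the Migliore construction with `α ≥ β + n - 2`, if
`s ≤ β - 2` then `A_n < β`, i.e. (since `d(Γ) = β`) the bound is not attained:
`d(Γ) > A_n`. -/
theorem migliore_small_s
    {K : Type} [Field K] [CharZero K] {n α β : ℕ} (hn : 2 ≤ n)
    (hα : 0 < α) (hβ : 0 < β)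
    (Γ₀ : Finset (Projectivization K (Fin n → K)))
    (hcard : Γ₀.card = α)
    (hgen : ∀ i, HF (vanishingIdeal (Γ₀ : Set (Projectivization K (Fin n → K)))) i =
      min ((i + n - 1).choose (n - 1)) α)
    (u : Fin β → K) (hu : Function.Injective u)
    (s : ℕ) (hs : α < (s + n - 1).choose (n - 1))
    (hsmin : ∀ j, α < (j + n - 1).choose (n - 1) → s ≤ j)
    (v : ℕ) (hvs : v = s ∨ v = s + 1)
    (hv : vanishingIdeal (Γ₀ : Set (Projectivization K (Fin n → K))) ⊔
        Ideal.span {f | ∃ i : Fin n, 1 ≤ (i : ℕ) ∧ f = X i} =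
      Ideal.span ({X (⟨0, by omega⟩ : Fin n) ^ v} ∪ {f | ∃ i : Fin n, 1 ≤ (i : ℕ) ∧ f = X i}))
    (hαβ : β + n - 2 ≤ α)
    (hhyp : hyp (MigGamma Γ₀ u) = α)
    (res : MinFreeRes (n + 1) K
      (vanishingIdeal ((MigGamma Γ₀ u) : Set (Projectivization K (Fin (n + 1) → K)))))
    (hlen : res.len = n)
    (hsβ : s ≤ β - 2) :
    res.A < (β : ℤ) ∧ res.A < (minDist (MigGamma Γ₀ u) : ℤ) := by
  have hs1 : 1 ≤ s := by
    rcases Nat.eq_zero_or_pos s with rfl | h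
    · simp at hs; omega
    · exact h
  have hHF : HF (vanishingIdeal (Γ₀ : Set (Projectivization K (Fin n → K)))) s = Γ₀.card := by
    rw [hgen, hcard]; exact min_eq_right hs.le
  have hQ : ∃ Q ∈ Γ₀, ∃ j : Fin n, 1 ≤ (j : ℕ) ∧ Q.rep j ≠ 0 := by
    by_contra hcon
    push Not at hcon
    have : Γ₀.card ≤ 1 := by
      rw [Finset.card_le_one]
      intro P hP Q hQ
      let z : Fin n := ⟨0, by omega⟩
      have key : ∀ P ∈ Γ₀, P.rep z ≠ 0 := by
        intro P hP h0
        apply P.rep_nonzero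
        funext j
        by_cases hj : 1 ≤ (j : ℕ)
        · exact hcon P hP j hj
        · have : j = z := Fin.ext (by simp [z]; omega)
          rw [this, h0]; rfl
      rw [← P.mk_rep, ← Q.mk_rep, Projectivization.mk_eq_mk_iff']
      refine ⟨P.rep z / Q.rep z, funext fun j => ?_⟩
      by_cases hj : 1 ≤ (j : ℕ)
      · simp [hcon P hP j hj, hcon Q hQ j hj]
      · have : j = z := Fin.ext (by simp [z]; omega)
        rw [this]
        simp [div_mul_cancel₀ _ (key Q hQ)]
    omega
  obtain ⟨Q, hQ, j, hj, hQj⟩ := hQ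
  obtain ⟨f, hf, hfQ, hfP⟩ := exists_sep Γ₀ s (by omega) hHF Q hQ
  obtain ⟨g, κ, w, hg, hgI, hgy⟩ := mig_sep Γ₀ u s Q hQ j hj hQj f hf hfQ hfP
  have hA := A_le_of_sep res (by omega) hlen (s + 1) g hg hgI κ w hgy
  have hd : minDist (MigGamma Γ₀ u) = β := by
    rw [minDist, hhyp, card_mig hn Γ₀ u hu]; omega
  rw [hd]
  push_cast at hA
  constructor <;> omega

end PointsMinDist
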